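/- arXiv:2512.23190 — 2 statements merged into one kernel-verified Lean document; each statement's English description precedes it below -/
import Mathlib

section
/- Consider a run of LightONS.Core over T rounds on the domain X, with d ≥ 1. Then for every u ∈ X, Σ_{t=1}^{T} (f_t(x_t) − f_t(u)) ≤ (d/(2γ))·log(1 + G²·T/(d·ε)) + γ·ε·D²/8, where γ = (1/2)·min{2/((k+1)DG), α}. -/
open scoped RealInnerProductSpace

noncomputable def mApp {d : ℕ} (A : Matrix (Fin d) (Fin d) ℝ) (x : EuclideanSpace ℝ (Fin d)) :
    EuclideanSpace ℝ (Fin d) :=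
  Matrix.toEuclideanLin A x

noncomputable def quadForm {d : ℕ} (A : Matrix (Fin d) (Fin d) ℝ) (x : EuclideanSpace ℝ (Fin d)) : ℝ :=
  ⟪x, mApp A x⟫

noncomputable def mnorm {d : ℕ} (A : Matrix (Fin d) (Fin d) ℝ) (x : EuclideanSpace ℝ (Fin d)) : ℝ :=
  Real.sqrt (quadForm A x)

/-- `p` is a Mahalanobis projection of `y` onto `C` with respect to `A`. -/
def IsMProj {d : ℕ} (A : Matrix (Fin d) (Fin d) ℝ) (C : Set (EuclideanSpace ℝ (Fin d)))
    (y p : EuclideanSpace ℝ (Fin d)) : Prop :=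
  p ∈ C ∧ ∀ z ∈ C, mnorm A (p - y) ≤ mnorm A (z - y)

/-- The outer product `v vᵀ` of a vector with itself. -/
noncomputable def outerProd {d : ℕ} (v : EuclideanSpace ℝ (Fin d)) : Matrix (Fin d) (Fin d) ℝ :=
  Matrix.of (fun i j => v i * v j)

lemma log_one_add_le_sub_sq_div_four {y : ℝ} (h₁ : -1 < y) (h₂ : y ≤ 1) :
    Real.log (1 + y) ≤ y - y ^ 2 / 4 := by
  rcases le_total 0 y with hy | hy
  · rw [Real.log_le_iff_le_exp (by linarith)]
    have hw : 0 ≤ y - y ^ 2 / 4 := by nlinarith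
    have hs : 3 / 4 * y ≤ y - y ^ 2 / 4 := by nlinarith
    nlinarith [Real.quadratic_le_exp_of_nonneg hw]
  · have hpos : 0 < 1 + y := by linarith
    have hsqrt : √(1 + y) ≤ 1 + y / 2 - y ^ 2 / 8 := by
      rw [Real.sqrt_le_left (by nlinarith)]
      nlinarith [mul_nonneg (sq_nonneg y) (neg_nonneg.2 hy), sq_nonneg (y ^ 2)]
    have hlog := Real.log_le_sub_one_of_pos (Real.sqrt_pos.2 hpos)
    rw [Real.log_sqrt hpos.le] at hlog
    linarith

lemma inv_mul_log_one_add_mul_le {α β s : ℝ} (hβ : 0 < β) (hβα : β ≤ α) (hs : 0 < 1 + α * s) :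
    0 < 1 + β * s ∧ α⁻¹ * Real.log (1 + α * s) ≤ β⁻¹ * Real.log (1 + β * s) := by
  have hα : 0 < α := hβ.trans_le hβα
  have hp := rpow_one_add_le_one_add_mul_self (s := α * s) (by linarith)
    (div_nonneg hβ.le hα.le) ((div_le_one hα).2 hβα)
  have hmul : β / α * (α * s) = β * s := by field_simp
  rw [hmul] at hp
  have hpow := Real.rpow_pos_of_pos hs (β / α)
  refine ⟨hpow.trans_le hp, ?_⟩
  have hlog := Real.log_le_log hpow hp
  rw [Real.log_rpow hs] at hlog
  calc α⁻¹ * Real.log (1 + α * s) = β⁻¹ * (β / α * Real.log (1 + α * s)) := by field_simp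
    _ ≤ _ := by gcongr

lemma ConcaveOn.le_add_inner_gradient {E : Type*} [NormedAddCommGroup E] [InnerProductSpace ℝ E]
    [CompleteSpace E] {S : Set E} {F : E → ℝ} {x u v : E} (hF : ConcaveOn ℝ S F)
    (hx : x ∈ S) (hu : u ∈ S) (hgrad : HasGradientAt F v x) :
    F u ≤ F x + ⟪v, u - x⟫ := by
  have hline := hF.comp_affineMap (AffineMap.lineMap x u)
  have hderiv : HasDerivAt (F ∘ AffineMap.lineMap (k := ℝ) x u) ⟪v, u - x⟫ 0 := by
    have hfd : HasFDerivAt F (InnerProductSpace.toDual ℝ E v) (AffineMap.lineMap x u (0 : ℝ)) := by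
      simpa using hgrad.hasFDerivAt
    simpa using hfd.comp_hasDerivAt (0 : ℝ) (AffineMap.hasDerivAt_lineMap (a := x) (b := u))
  have hslope := hline.slope_le_of_hasDerivAt (x := 0) (y := 1) (by simpa using hx)
    (by simpa using hu) one_pos hderiv
  simp [slope_def_field] at hslope
  linarith

/-- The quadratic lower bound satisfied by an exp-concave function. -/
lemma sub_le_of_concaveOn_exp {E : Type*} [NormedAddCommGroup E] [InnerProductSpace ℝ E]
    [CompleteSpace E] {S : Set E} {f : E → ℝ} {x u v : E} {α γ : ℝ} (hγ : 0 < γ)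
    (hγα : 2 * γ ≤ α) (hf : ConcaveOn ℝ S fun z => Real.exp (-α * f z)) (hx : x ∈ S) (hu : u ∈ S)
    (hgrad : HasGradientAt f v x) (hbound : 2 * γ * |⟪v, x - u⟫| ≤ 1) :
    f x - f u ≤ ⟪v, x - u⟫ - γ / 2 * ⟪v, x - u⟫ ^ 2 := by
  set w := ⟪v, x - u⟫ with hw
  have hα : 0 < α := by linarith
  have hexp : HasGradientAt (fun z => Real.exp (-α * f z))
      ((Real.exp (-α * f x) * -α) • v) x := by
    rw [hasGradientAt_iff_hasFDerivAt] at hgrad ⊢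
    have hderiv := (hgrad.const_mul (-α)).exp
    rwa [smul_smul, ← map_smul] at hderiv
  have hfirst := hf.le_add_inner_gradient hx hu hexp
  rw [real_inner_smul_left, ← neg_sub x u, inner_neg_right, ← hw] at hfirst
  have hmul : Real.exp (-α * f u) ≤ Real.exp (-α * f x) * (1 + α * w) := by
    linarith
  have hpos : 0 < 1 + α * w :=
    pos_of_mul_pos_right ((Real.exp_pos _).trans_le hmul) (Real.exp_pos _).le
  have hlog := Real.log_le_log (Real.exp_pos _) hmul
  rw [Real.log_mul (Real.exp_pos _).ne' hpos.ne', Real.log_exp, Real.log_exp] at hlog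
  have hdiff : f x - f u ≤ α⁻¹ * Real.log (1 + α * w) := by
    rw [inv_mul_eq_div, le_div_iff₀ hα]
    linarith
  obtain ⟨hpos', hle⟩ := inv_mul_log_one_add_mul_le (by positivity : 0 < 2 * γ) hγα hpos
  have habs : 2 * γ * w ≤ 1 :=
    (mul_le_mul_of_nonneg_left (le_abs_self w) (by positivity)).trans hbound
  have hquad := log_one_add_le_sub_sq_div_four (by linarith) habs
  calc f x - f u ≤ (2 * γ)⁻¹ * Real.log (1 + 2 * γ * w) := hdiff.trans hle
    _ ≤ (2 * γ)⁻¹ * (2 * γ * w - (2 * γ * w) ^ 2 / 4) := by gcongr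
    _ = w - γ / 2 * w ^ 2 := by field_simp; ring

section Mahalanobis

variable {d : ℕ}

lemma ofLp_mApp (A : Matrix (Fin d) (Fin d) ℝ) (x : EuclideanSpace ℝ (Fin d)) :
    (mApp A x).ofLp = A.mulVec x.ofLp := rfl

lemma inner_mApp_comm {A : Matrix (Fin d) (Fin d) ℝ} (hA : A.IsHermitian)
    (x y : EuclideanSpace ℝ (Fin d)) : ⟪x, mApp A y⟫ = ⟪y, mApp A x⟫ := by
  rw [real_inner_comm, mApp, mApp]
  exact Matrix.isSymmetric_toEuclideanLin_iff.2 hA y x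

lemma quadForm_add {A : Matrix (Fin d) (Fin d) ℝ} (hA : A.IsHermitian)
    (x y : EuclideanSpace ℝ (Fin d)) :
    quadForm A (x + y) = quadForm A x + 2 * ⟪x, mApp A y⟫ + quadForm A y := by
  have hsymm := inner_mApp_comm hA y x
  simp only [quadForm, mApp, map_add, inner_add_left, inner_add_right] at hsymm ⊢
  linarith

lemma quadForm_smul (A : Matrix (Fin d) (Fin d) ℝ) (c : ℝ) (x : EuclideanSpace ℝ (Fin d)) :
    quadForm A (c • x) = c ^ 2 * quadForm A x := by
  simp only [quadForm, mApp, map_smul, real_inner_smul_left, real_inner_smul_right]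
  ring

lemma quadForm_nonneg {A : Matrix (Fin d) (Fin d) ℝ} (hA : A.PosSemidef)
    (x : EuclideanSpace ℝ (Fin d)) : 0 ≤ quadForm A x :=
  (Matrix.isPositive_toEuclideanLin_iff.2 hA).inner_nonneg_right x

lemma outerProd_eq_vecMulVec (v : EuclideanSpace ℝ (Fin d)) :
    outerProd v = Matrix.vecMulVec v.ofLp v.ofLp := rfl

lemma inner_eq_dotProduct (x y : EuclideanSpace ℝ (Fin d)) : ⟪x, y⟫ = x.ofLp ⬝ᵥ y.ofLp := by
  simp [PiLp.inner_apply, dotProduct, mul_comm]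

lemma quadForm_add_outerProd (A : Matrix (Fin d) (Fin d) ℝ) (v x : EuclideanSpace ℝ (Fin d)) :
    quadForm (A + outerProd v) x = quadForm A x + ⟪v, x⟫ ^ 2 := by
  have hcomm := dotProduct_comm x.ofLp v.ofLp
  simp only [quadForm, inner_eq_dotProduct, ofLp_mApp, Matrix.add_mulVec, dotProduct_add,
    outerProd_eq_vecMulVec, Matrix.vecMulVec_mulVec]
  simp [hcomm, sq]

lemma quadForm_smul_one (ε : ℝ) (x : EuclideanSpace ℝ (Fin d)) :
    quadForm (ε • (1 : Matrix (Fin d) (Fin d) ℝ)) x = ε * ‖x‖ ^ 2 := by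
  rw [quadForm, ← real_inner_self_eq_norm_sq, inner_eq_dotProduct, inner_eq_dotProduct, ofLp_mApp]
  simp [Matrix.smul_mulVec]

lemma mApp_mApp_inv {A : Matrix (Fin d) (Fin d) ℝ} (hA : A.PosDef)
    (v : EuclideanSpace ℝ (Fin d)) : mApp A (mApp A⁻¹ v) = v := by
  have hdet := (Matrix.isUnit_iff_isUnit_det A).1 hA.isUnit
  ext1
  simp [mApp, Matrix.mulVec_mulVec, Matrix.mul_nonsing_inv A hdet]

lemma Matrix.PosDef.add_outerProd {A : Matrix (Fin d) (Fin d) ℝ} (hA : A.PosDef)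
    (v : EuclideanSpace ℝ (Fin d)) : (A + outerProd v).PosDef :=
  hA.add_posSemidef (Matrix.posSemidef_vecMulVec_self_star v.ofLp)

lemma trace_outerProd (v : EuclideanSpace ℝ (Fin d)) : (outerProd v).trace = ‖v‖ ^ 2 := by
  rw [outerProd_eq_vecMulVec, Matrix.trace_vecMulVec, ← real_inner_self_eq_norm_sq,
    inner_eq_dotProduct]

/-- A preconditioned gradient step changes the Mahalanobis distance to `u` as follows. -/
lemma quadForm_gradient_step {A : Matrix (Fin d) (Fin d) ℝ} (hA : A.PosDef) (c : ℝ)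
    (x u v : EuclideanSpace ℝ (Fin d)) :
    quadForm A (x - c • mApp A⁻¹ v - u) =
      quadForm A (x - u) - 2 * c * ⟪v, x - u⟫ + c ^ 2 * ⟪v, mApp A⁻¹ v⟫ := by
  have hdecomp : x - c • mApp A⁻¹ v - u = (x - u) + (-c) • mApp A⁻¹ v := by
    rw [neg_smul]; abel
  have hlin : mApp A ((-c) • mApp A⁻¹ v) = (-c) • v := by
    conv_rhs => rw [← mApp_mApp_inv hA v]
    simp only [mApp, map_smul]
  rw [hdecomp, quadForm_add hA.isHermitian, quadForm_smul, hlin, quadForm, quadForm,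
    mApp_mApp_inv hA, real_inner_smul_right, real_inner_comm v (mApp A⁻¹ v),
    real_inner_comm v (x - u)]
  ring

lemma IsMProj.quadForm_sub_le {A : Matrix (Fin d) (Fin d) ℝ}
    {C : Set (EuclideanSpace ℝ (Fin d))} {y p u : EuclideanSpace ℝ (Fin d)}
    (h : IsMProj A C y p) (hA : A.PosSemidef) (hC : Convex ℝ C) (hu : u ∈ C) :
    quadForm A (p - u) ≤ quadForm A (y - u) := by
  have hneg (z : EuclideanSpace ℝ (Fin d)) : quadForm A (-z) = quadForm A z := by
    simpa using quadForm_smul A (-1) z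
  set b := ⟪p - y, mApp A (u - p)⟫ with hb
  set q := quadForm A (u - p) with hq
  have hq0 : 0 ≤ q := quadForm_nonneg hA _
  have hexpand (s : ℝ) : quadForm A (p + s • (u - p) - y) =
      quadForm A (p - y) + 2 * s * b + s ^ 2 * q := by
    rw [add_sub_right_comm, quadForm_add hA.isHermitian, quadForm_smul, mApp, map_smul,
      real_inner_smul_right]
    simp only [hb, hq, mApp]
    ring
  have hmin (s : ℝ) (hs : 0 < s) (hs1 : s ≤ 1) : 0 ≤ 2 * b + s * q := by
    have hle := h.2 _ (hC.add_smul_sub_mem h.1 hu ⟨hs.le, hs1⟩)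
    rw [mnorm, mnorm, Real.sqrt_le_sqrt_iff (quadForm_nonneg hA _), hexpand] at hle
    have : 0 ≤ s * (2 * b + s * q) := by linarith
    exact nonneg_of_mul_nonneg_right this hs
  have hb0 : 0 ≤ b := by
    by_contra! hlt
    have hs : 0 < min 1 (-b / (q + 1)) := lt_min one_pos (by apply div_pos <;> linarith)
    have hbound : min 1 (-b / (q + 1)) * q ≤ -b := by
      calc _ ≤ -b / (q + 1) * (q + 1) := by
            gcongr
            · exact div_nonneg (by linarith) (by linarith)
            · exact min_le_right _ _
            · linarith
        _ = -b := by field_simp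
    linarith [hmin _ hs (min_le_left _ _)]
  have hone := hexpand 1
  rw [one_smul, add_sub_cancel] at hone
  rw [← neg_sub u p, hneg, ← neg_sub u y, hneg, hone]
  linarith [quadForm_nonneg hA (p - y)]

/-- The elliptical potential inequality for a rank-one update. -/
lemma inner_mApp_inv_le_log_det_sub {A : Matrix (Fin d) (Fin d) ℝ} (hA : A.PosDef)
    (v : EuclideanSpace ℝ (Fin d)) :
    ⟪v, mApp (A + outerProd v)⁻¹ v⟫ ≤
      Real.log (A + outerProd v).det - Real.log A.det := by
  have hB := hA.add_outerProd v
  set B := A + outerProd v with hBdef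
  have hdet : A.det = B.det * (1 - ⟪v, mApp B⁻¹ v⟫) := by
    have hA' : A = B + Matrix.replicateCol Unit (-v.ofLp) * Matrix.replicateRow Unit v.ofLp := by
      rw [← Matrix.vecMulVec_eq Unit, Matrix.neg_vecMulVec, ← outerProd_eq_vecMulVec, hBdef]
      abel
    rw [hA', Matrix.det_add_replicateCol_mul_replicateRow
      ((Matrix.isUnit_iff_isUnit_det B).1 hB.isUnit), inner_eq_dotProduct, ofLp_mApp,
      Matrix.mul_assoc, ← Matrix.replicateCol_mulVec, Matrix.mulVec_neg]
    simp [Matrix.det_unique, Matrix.mul_apply, dotProduct, sub_eq_add_neg]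
  have hpos : 0 < 1 - ⟪v, mApp B⁻¹ v⟫ := by
    have := hA.det_pos
    rw [hdet] at this
    exact pos_of_mul_pos_right this hB.det_pos.le
  have hlog := Real.log_le_sub_one_of_pos hpos
  rw [hdet, Real.log_mul hB.det_pos.ne' hpos.ne']
  linarith

lemma Matrix.PosDef.log_det_le {A : Matrix (Fin d) (Fin d) ℝ} (hA : A.PosDef) {c : ℝ} (hc : 0 < c)
    (htrace : A.trace ≤ d * c) : Real.log A.det ≤ d * Real.log c := by
  have hdet : A.det = ∏ i, hA.isHermitian.eigenvalues i := by
    simpa using hA.isHermitian.det_eq_prod_eigenvalues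
  have htr : A.trace = ∑ i, hA.isHermitian.eigenvalues i := by
    simpa using hA.isHermitian.trace_eq_sum_eigenvalues
  rw [hdet, Real.log_prod fun i _ => (hA.eigenvalues_pos i).ne']
  have hterm (i : Fin d) : Real.log (hA.isHermitian.eigenvalues i) ≤
      hA.isHermitian.eigenvalues i / c - 1 + Real.log c := by
    have := Real.log_le_sub_one_of_pos (div_pos (hA.eigenvalues_pos i) hc)
    rw [Real.log_div (hA.eigenvalues_pos i).ne' hc.ne'] at this
    linarith
  have hfrac : A.trace / c ≤ d := (div_le_iff₀ hc).2 htrace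
  calc ∑ i, Real.log (hA.isHermitian.eigenvalues i)
      ≤ ∑ i, (hA.isHermitian.eigenvalues i / c - 1 + Real.log c) :=
        Finset.sum_le_sum fun i _ => hterm i
    _ = A.trace / c - d + d * Real.log c := by
        rw [htr, Finset.sum_add_distrib, Finset.sum_sub_distrib, Finset.sum_div]
        simp
    _ ≤ d * Real.log c := by linarith

end Mahalanobis

/-- regret of LightONS.Core.
Rounds are indexed by `t ∈ {0, …, T-1}` (round `t+1` in the paper); the iterate `x t` is the
paper's `x_{t+1}`, and `A t` is the paper's `A_t`. -/
theorem stmt_5 {d T : ℕ} (hd : 1 ≤ d)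
    (X : Set (EuclideanSpace ℝ (Fin d))) (hne : X.Nonempty) (hcmp : IsCompact X)
    (hconv : Convex ℝ X)
    (D G α ε k : ℝ) (hD : 0 < D) (hG : 0 < G) (hα : 0 < α) (hε : 0 < ε) (hk : 1 < k)
    (hdiam : ∀ x ∈ X, ∀ y ∈ X, ‖x - y‖ ≤ D)
    (hXball : ∀ x ∈ X, ‖x‖ ≤ D / 2)
    (f : ℕ → EuclideanSpace ℝ (Fin d) → ℝ)
    (g : ℕ → EuclideanSpace ℝ (Fin d) → EuclideanSpace ℝ (Fin d))
    (hexp : ∀ t < T, ConcaveOn ℝ (Metric.closedBall (0 : EuclideanSpace ℝ (Fin d)) (k*D/2))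
      (fun z => Real.exp (-α * f t z)))
    (hgrad : ∀ t < T, ∀ z ∈ Metric.closedBall (0 : EuclideanSpace ℝ (Fin d)) (k*D/2),
      HasGradientAt (f t) (g t z) z)
    (hgbound : ∀ t < T, ∀ z ∈ Metric.closedBall (0 : EuclideanSpace ℝ (Fin d)) (k*D/2),
      ‖g t z‖ ≤ G)
    (γ : ℝ) (hγ : γ = (1/2) * min (2 / ((k+1)*D*G)) α)
    (x xhat : ℕ → EuclideanSpace ℝ (Fin d)) (A : ℕ → Matrix (Fin d) (Fin d) ℝ)
    (hx0 : x 0 = 0)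
    (hA0 : A 0 = ε • (1 : Matrix (Fin d) (Fin d) ℝ))
    (hAstep : ∀ t < T, A (t+1) = A t + outerProd (g t (x t)))
    (hxhat : ∀ t < T, xhat (t+1) = x t - (1/γ) • mApp (A (t+1))⁻¹ (g t (x t)))
    (hupd₁ : ∀ t < T, ‖xhat (t+1)‖ ≤ k*D/2 → x (t+1) = xhat (t+1))
    (hupd₂ : ∀ t < T, ¬ (‖xhat (t+1)‖ ≤ k*D/2) → IsMProj (A (t+1)) X (xhat (t+1)) (x (t+1))) :
    ∀ u ∈ X, (∑ t ∈ Finset.range T, (f t (x t) - f t u))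
      ≤ (d / (2*γ)) * Real.log (1 + G^2 * T / (d * ε)) + γ * ε * D^2 / 8 := by
  intro u hu
  set S := Metric.closedBall (0 : EuclideanSpace ℝ (Fin d)) (k * D / 2) with hS
  have hkD : D / 2 ≤ k * D / 2 := by nlinarith
  have hd0 : (0 : ℝ) < d := by exact_mod_cast hd
  have hXS : X ⊆ S := fun z hz => mem_closedBall_zero_iff.2 ((hXball z hz).trans hkD)
  have hden : 0 < (k + 1) * D * G := by positivity
  have hγ0 : 0 < γ := by rw [hγ]; positivity
  have hγα : 2 * γ ≤ α := by
    rw [hγ]; linarith [min_le_right (2 / ((k + 1) * D * G)) α]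
  have hγG : γ * ((k + 1) * D * G) ≤ 1 := by
    have : γ ≤ 1 / ((k + 1) * D * G) := by
      have := min_le_left (2 / ((k + 1) * D * G)) α
      calc γ ≤ 1 / 2 * (2 / ((k + 1) * D * G)) := by rw [hγ]; gcongr
        _ = _ := by ring
    exact (le_div_iff₀ hden).1 this
  have hinv (n : ℕ) (hn : n ≤ T) :
      (A n).PosDef ∧ x n ∈ S ∧ (A n).trace ≤ d * ε + n * G ^ 2 ∧
      ∑ t ∈ Finset.range n, (f t (x t) - f t u) ≤
        1 / (2 * γ) * (Real.log (A n).det - Real.log (A 0).det) +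
          γ / 2 * (quadForm (A 0) (x 0 - u) - quadForm (A n) (x n - u)) := by
    induction n with
    | zero =>
      refine ⟨hA0 ▸ Matrix.PosDef.one.smul hε, ?_, ?_, by simp⟩
      · rw [hx0, hS]; exact Metric.mem_closedBall_self (by positivity)
      · simp [hA0, mul_comm]
    | succ n ih =>
      have hnT : n < T := hn
      obtain ⟨hpd, hxS, htr, hsum⟩ := ih hnT.le
      have hpd' : (A (n + 1)).PosDef := by rw [hAstep n hnT]; exact hpd.add_outerProd _
      have hgn := hgbound n hnT _ hxS
      have hxu : ‖x n - u‖ ≤ (k + 1) * D / 2 := by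
        have := mem_closedBall_zero_iff.1 hxS
        linarith [norm_sub_le (x n) u, hXball u hu]
      have hinner : 2 * γ * |⟪g n (x n), x n - u⟫| ≤ 1 := by
        have habs : |⟪g n (x n), x n - u⟫| ≤ G * ((k + 1) * D / 2) :=
          (abs_real_inner_le_norm _ _).trans (mul_le_mul hgn hxu (norm_nonneg _) hG.le)
        calc _ ≤ 2 * γ * (G * ((k + 1) * D / 2)) := by gcongr
          _ = γ * ((k + 1) * D * G) := by ring
          _ ≤ 1 := hγG
      have hloss := sub_le_of_concaveOn_exp hγ0 hγα (hexp n hnT) hxS (hXS hu)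
        (hgrad n hnT _ hxS) hinner
      have hlogdet := inner_mApp_inv_le_log_det_sub hpd (g n (x n))
      rw [← hAstep n hnT] at hlogdet
      have hnext : x (n + 1) ∈ S ∧
          quadForm (A (n + 1)) (x (n + 1) - u) ≤ quadForm (A (n + 1)) (xhat (n + 1) - u) := by
        by_cases hball : ‖xhat (n + 1)‖ ≤ k * D / 2
        · rw [hupd₁ n hnT hball]
          exact ⟨mem_closedBall_zero_iff.2 hball, le_rfl⟩
        · have hproj := hupd₂ n hnT hball
          exact ⟨hXS hproj.1, hproj.quadForm_sub_le hpd'.posSemidef hconv hu⟩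
      refine ⟨hpd', hnext.1, ?_, ?_⟩
      · rw [hAstep n hnT, Matrix.trace_add, trace_outerProd]
        have : ‖g n (x n)‖ ^ 2 ≤ G ^ 2 := by gcongr
        push_cast
        linarith
      · have hstep := hnext.2
        rw [hxhat n hnT, quadForm_gradient_step hpd'] at hstep
        have hgrow : quadForm (A (n + 1)) (x n - u) =
            quadForm (A n) (x n - u) + ⟪g n (x n), x n - u⟫ ^ 2 := by
          rw [hAstep n hnT, quadForm_add_outerProd]
        rw [hgrow] at hstep
        have hscaled := mul_le_mul_of_nonneg_left hstep (by positivity : 0 ≤ γ / 2)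
        have hlog := mul_le_mul_of_nonneg_left hlogdet (by positivity : 0 ≤ 1 / (2 * γ))
        have hexpand (q w p : ℝ) : γ / 2 * (q + w ^ 2 - 2 * (1 / γ) * w + (1 / γ) ^ 2 * p) =
            γ / 2 * q + γ / 2 * w ^ 2 - w + 1 / (2 * γ) * p := by
          field_simp
        rw [hexpand] at hscaled
        rw [Finset.sum_range_succ]
        linarith
  obtain ⟨hpd, -, htr, hsum⟩ := hinv T le_rfl
  have hc : 0 < ε + T * G ^ 2 / d := by positivity
  have hdetT := hpd.log_det_le hc (htr.trans_eq (by field_simp))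
  have hdet0 : Real.log (A 0).det = d * Real.log ε := by simp [hA0]
  have hdiff : Real.log (A T).det - Real.log (A 0).det ≤
      d * Real.log (1 + G ^ 2 * T / (d * ε)) := by
    have hfac : ε + T * G ^ 2 / d = ε * (1 + G ^ 2 * T / (d * ε)) := by field_simp
    rw [hfac, Real.log_mul hε.ne' (by positivity)] at hdetT
    linarith
  have hinit : quadForm (A 0) (x 0 - u) ≤ ε * (D / 2) ^ 2 := by
    rw [hA0, quadForm_smul_one, hx0, zero_sub, norm_neg]
    gcongr
    exact hXball u hu
  have hfinal := quadForm_nonneg hpd.posSemidef (x T - u)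
  calc _ ≤ _ := hsum
    _ ≤ 1 / (2 * γ) * (d * Real.log (1 + G ^ 2 * T / (d * ε))) + γ / 2 * (ε * (D / 2) ^ 2) := by
        gcongr
        linarith
    _ = _ := by ring
end

section
/- Let A ∈ ℝ^{d×d} be a positive-definite symmetric matrix with smallest eigenvalue λ_min and largest eigenvalue λ_max, let R > 0, and let y ∈ ℝ^d with ‖y‖ > R. If μ* > 0 satisfies ‖(A + μ*I)⁻¹Ay‖ = R, then (‖y‖/R − 1)·λ_min ≤ μ* ≤ (‖y‖/R − 1)·λ_max. -/
open scoped RealInnerProductSpace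

theorem mApp_mApp {d : ℕ} (A B : Matrix (Fin d) (Fin d) ℝ) (x : EuclideanSpace ℝ (Fin d)) :
    mApp A (mApp B x) = mApp (A * B) x := by
  simp [mApp, Matrix.toLpLin_apply, Matrix.mulVec_mulVec]

theorem mApp_one {d : ℕ} (x : EuclideanSpace ℝ (Fin d)) :
    mApp (1 : Matrix (Fin d) (Fin d) ℝ) x = x := by
  simp [mApp]

theorem inner_eigenvectorBasis_mApp {d : ℕ} {A : Matrix (Fin d) (Fin d) ℝ} (hA : A.IsHermitian)
    (x : EuclideanSpace ℝ (Fin d)) (i : Fin d) :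
    ⟪hA.eigenvectorBasis i, mApp A x⟫ = hA.eigenvalues i * ⟪hA.eigenvectorBasis i, x⟫ := by
  have h : Matrix.toEuclideanLin A (hA.eigenvectorBasis i) =
      hA.eigenvalues i • hA.eigenvectorBasis i := by
    rw [Matrix.toLpLin_apply, hA.mulVec_eigenvectorBasis]
    rfl
  rw [mApp, ← Matrix.isSymmetric_toEuclideanLin_iff.mpr hA, h, real_inner_smul_left]

theorem OrthonormalBasis.norm_le_norm_of_abs_inner_le {ι E : Type*} [Fintype ι]
    [NormedAddCommGroup E] [InnerProductSpace ℝ E] (b : OrthonormalBasis ι ℝ E) {u v : E}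
    (h : ∀ i, |⟪b i, u⟫| ≤ |⟪b i, v⟫|) : ‖u‖ ≤ ‖v‖ := by
  rw [← sq_le_sq₀ (norm_nonneg _) (norm_nonneg _), ← b.sum_sq_norm_inner_right u,
    ← b.sum_sq_norm_inner_right v]
  exact Finset.sum_le_sum fun i _ => pow_le_pow_left₀ (norm_nonneg _) (h i) 2

/-- If `(l + m) x = l y` and `a ≤ l`, then `a |y| ≤ (a + m) |x|`. -/
theorem abs_mul_le_abs_add_mul {a l m x y : ℝ} (ha : 0 ≤ a) (hal : a ≤ l) (hl : 0 < l)
    (hm : 0 ≤ m) (h : (l + m) * x = l * y) : |a * y| ≤ |(a + m) * x| := by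
  obtain rfl : y = (l + m) * x / l := by field_simp; linarith
  rw [← mul_div_assoc, ← mul_assoc, mul_div_right_comm, abs_mul, abs_mul]
  refine mul_le_mul_of_nonneg_right ?_ (abs_nonneg x)
  rw [abs_of_nonneg (by positivity), abs_of_nonneg (by positivity), div_le_iff₀ hl]
  nlinarith

/-- If `(l + m) x = l y` and `l ≤ a`, then `(a + m) |x| ≤ a |y|`. -/
theorem abs_add_mul_le_abs_mul {a l m x y : ℝ} (hla : l ≤ a) (hl : 0 < l)
    (hm : 0 ≤ m) (h : (l + m) * x = l * y) : |(a + m) * x| ≤ |a * y| := by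
  obtain rfl : y = (l + m) * x / l := by field_simp; linarith
  have ha : 0 < a := hl.trans_le hla
  rw [← mul_div_assoc, ← mul_assoc, mul_div_right_comm, abs_mul, abs_mul]
  refine mul_le_mul_of_nonneg_right ?_ (abs_nonneg x)
  rw [abs_of_nonneg (by positivity), abs_of_nonneg (by positivity), le_div_iff₀ hl]
  nlinarith

/-- bounds on the optimal dual variable `μ*`: if `μ* > 0` satisfies
`‖(A + μ*I)⁻¹Ay‖ = R` with `‖y‖ > R`, then
`(‖y‖/R − 1)·λ_min ≤ μ* ≤ (‖y‖/R − 1)·λ_max`. -/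
theorem stmt_13 {d : ℕ} (A : Matrix (Fin d) (Fin d) ℝ) (hA : A.PosDef)
    (lmin lmax : ℝ)
    (hlmin : IsLeast (Set.range hA.1.eigenvalues) lmin)
    (hlmax : IsGreatest (Set.range hA.1.eigenvalues) lmax)
    (R : ℝ) (hR : 0 < R) (y : EuclideanSpace ℝ (Fin d)) (hy : R < ‖y‖)
    (μstar : ℝ) (hμpos : 0 < μstar)
    (hμ : ‖mApp (A + μstar • (1 : Matrix (Fin d) (Fin d) ℝ))⁻¹ (mApp A y)‖ = R) :
    (‖y‖ / R - 1) * lmin ≤ μstar ∧ μstar ≤ (‖y‖ / R - 1) * lmax := by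
  set x := mApp (A + μstar • (1 : Matrix (Fin d) (Fin d) ℝ))⁻¹ (mApp A y) with hx
  have hpd : (A + μstar • (1 : Matrix (Fin d) (Fin d) ℝ)).PosDef :=
    hA.add (Matrix.PosDef.one.smul hμpos)
  have hdet : IsUnit (A + μstar • (1 : Matrix (Fin d) (Fin d) ℝ)).det :=
    hpd.det_pos.ne'.isUnit
  have hAx : mApp A x + μstar • x = mApp A y := by
    have h : mApp (A + μstar • (1 : Matrix (Fin d) (Fin d) ℝ)) x = mApp A y := by
      rw [hx, mApp_mApp, Matrix.mul_nonsing_inv _ hdet, mApp_one]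
    have h_add : mApp (A + μstar • (1 : Matrix (Fin d) (Fin d) ℝ)) x =
        mApp A x + μstar • mApp 1 x := by
      simp [mApp]
    rw [← h, h_add, mApp_one]
  have hcoord (i : Fin d) : (hA.1.eigenvalues i + μstar) * ⟪hA.1.eigenvectorBasis i, x⟫ =
      hA.1.eigenvalues i * ⟪hA.1.eigenvectorBasis i, y⟫ := by
    rw [← inner_eigenvectorBasis_mApp, ← hAx, inner_add_right, inner_eigenvectorBasis_mApp,
      real_inner_smul_right, add_mul]
  obtain ⟨⟨j, rfl⟩, hmin⟩ := hlmin
  obtain ⟨⟨k, rfl⟩, hmax⟩ := hlmax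
  have hj := hA.eigenvalues_pos j
  have hk := hA.eigenvalues_pos k
  have hlower : ‖hA.1.eigenvalues j • y‖ ≤ ‖(hA.1.eigenvalues j + μstar) • x‖ := by
    refine hA.1.eigenvectorBasis.norm_le_norm_of_abs_inner_le fun i => ?_
    rw [real_inner_smul_right, real_inner_smul_right]
    exact abs_mul_le_abs_add_mul hj.le (hmin ⟨i, rfl⟩) (hA.eigenvalues_pos i) hμpos.le (hcoord i)
  have hupper : ‖(hA.1.eigenvalues k + μstar) • x‖ ≤ ‖hA.1.eigenvalues k • y‖ := by
    refine hA.1.eigenvectorBasis.norm_le_norm_of_abs_inner_le fun i => ?_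
    rw [real_inner_smul_right, real_inner_smul_right]
    exact abs_add_mul_le_abs_mul (hmax ⟨i, rfl⟩) (hA.eigenvalues_pos i) hμpos.le (hcoord i)
  rw [norm_smul, norm_smul, hμ, Real.norm_of_nonneg (by positivity),
    Real.norm_of_nonneg (by positivity)] at hlower hupper
  rw [div_sub_one hR.ne', div_mul_eq_mul_div, div_mul_eq_mul_div, div_le_iff₀ hR, le_div_iff₀ hR]
  constructor <;> linarith
end
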